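/- Let p be a prime, r ≥ 1, d = p^{2r}, and let K be an algebraic closure of ℚ_p with its unique absolute value |·| extending the p-adic one. Let ζ ∈ K be a primitive d-th root of unity, and let U be the d×d matrix over K with entries U_{n,k} = [k choose n]_ζ for 0 ≤ n, k ≤ d−1 (so U is upper-triangular unipotent with entries of absolute value ≤ 1, and its inverse also has entries of absolute value ≤ 1). Then U is a sup-norm isometry of K^d: for every x ∈ K^d, max_{0≤n≤d−1} |(Ux)_n| = max_{0≤n≤d−1} |x_n|. -/

import Mathlib

/-- The `q`-Pochhammer symbol `(q;q)_n = ∏_{k=1}^n (1 - q^k)` in `ℤ[q]`. -/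
noncomputable def qPoch (n : ℕ) : Polynomial ℤ :=
  ∏ i ∈ Finset.range n, (1 - Polynomial.X ^ (i + 1))

theorem qPoch_ne_zero (n : ℕ) : qPoch n ≠ 0 := by
  refine Finset.prod_ne_zero_iff.mpr fun i _ h => ?_
  have h0 := congrArg (Polynomial.eval 0) h
  simp at h0

/-- An absolute value on a field that is bounded by one on the naturals is nonarchimedean. -/
theorem AbsoluteValue.isNonarchimedean_of_natCast_le_one {K : Type*} [Field K]
    (v : AbsoluteValue K ℝ) (h : ∀ n : ℕ, v n ≤ 1) : IsNonarchimedean v := by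
  let _ := v.toNormedField
  have hu : IsUltrametricDist K :=
    IsUltrametricDist.isUltrametricDist_of_forall_norm_natCast_le_one h
  exact fun x y => IsUltrametricDist.norm_add_le_max x y

theorem AbsoluteValue.aeval_int_le_one {K : Type*} [Field K] {v : AbsoluteValue K ℝ}
    (hv : IsNonarchimedean v) {a : K} (ha : v a ≤ 1) (P : Polynomial ℤ) :
    v (Polynomial.aeval a P) ≤ 1 := by
  induction P using Polynomial.induction_on' with
  | add P Q hP hQ =>
    rw [map_add]
    exact (hv _ _).trans (max_le hP hQ)
  | monomial n c =>
    rw [Polynomial.aeval_monomial, map_mul, map_pow]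
    refine mul_le_one₀ ?_ (pow_nonneg (v.nonneg _) _) (pow_le_one₀ (v.nonneg _) ha)
    simpa using hv.apply_intCast_le_one (n := c)

/-- A matrix with entries of absolute value at most one does not increase the sup norm. -/
theorem Matrix.iSup_mulVec_le {ι K : Type*} [Fintype ι] [Field K] {v : AbsoluteValue K ℝ}
    (hv : IsNonarchimedean v) {A : Matrix ι ι K} (hA : ∀ i j, v (A i j) ≤ 1) (x : ι → K) :
    ⨆ i, v (A.mulVec x i) ≤ ⨆ i, v (x i) := by
  refine Real.iSup_le (fun i => ?_) (Real.iSup_nonneg fun i => v.nonneg _)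
  obtain ⟨j, -, hj⟩ := hv.finset_image_add_of_nonempty (fun j => A i j * x j)
    (t := Finset.univ) ⟨i, Finset.mem_univ i⟩
  refine hj.trans ?_
  rw [map_mul]
  exact (mul_le_of_le_one_left (v.nonneg _) (hA i j)).trans
    (le_ciSup (f := fun i => v (x i)) (Set.finite_range _).bddAbove j)

/-- **`U` is a sup-norm isometry** (Ophir–de Shalit, §4.4).  `K` is an algebraic closure of
`ℚ_p` with its unique absolute value `v` extending the `p`-adic one, `ζ ∈ K` a primitive
`p^{2r}`-th root of unity, and `U` the `d×d` matrix with entries `U_{n,k} = [k choose n]_ζ`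
(`d = p^{2r}`).  Then for every `x ∈ K^d`, `max_n |(Ux)_n| = max_n |x_n|`.  Here `B` is the
Gaussian binomial coefficient `[n choose k]_q ∈ ℤ[q]`, characterized by
`[n choose k]_q (q;q)_k (q;q)_{n−k} = (q;q)_n` for `k ≤ n` and `[n choose k]_q = 0` for
`k > n`; `[k choose n]_ζ` is its evaluation at `q = ζ`. -/
theorem stmt_18 (p : ℕ) [Fact p.Prime] (r : ℕ) (hr : 1 ≤ r)
    (K : Type*) [Field K] [Algebra ℚ_[p] K] [IsAlgClosure ℚ_[p] K]
    (v : AbsoluteValue K ℝ)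
    (hv : ∀ x : ℚ_[p], v (algebraMap ℚ_[p] K x) = ‖x‖)
    (ζ : K) (hζ : IsPrimitiveRoot ζ (p ^ (2 * r)))
    (B : ℕ → ℕ → Polynomial ℤ)
    (hB0 : ∀ n k : ℕ, n < k → B n k = 0)
    (hB1 : ∀ n k : ℕ, k ≤ n → B n k * (qPoch k * qPoch (n - k)) = qPoch n)
    (U : Matrix (Fin (p ^ (2 * r))) (Fin (p ^ (2 * r))) K)
    (hU : ∀ n k : Fin (p ^ (2 * r)), U n k = Polynomial.aeval ζ (B (k : ℕ) (n : ℕ)))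
    (x : Fin (p ^ (2 * r)) → K) :
    (⨆ n : Fin (p ^ (2 * r)), v (U.mulVec x n)) = ⨆ n : Fin (p ^ (2 * r)), v (x n) := by
  have hna : IsNonarchimedean v := v.isNonarchimedean_of_natCast_le_one fun n => by
    rw [← map_natCast (algebraMap ℚ_[p] K) n, hv]
    exact_mod_cast Padic.norm_int_le_one (p := p) n
  have hζ1 : v ζ ≤ 1 := by
    have hd : p ^ (2 * r) ≠ 0 := pow_ne_zero _ (Fact.out : p.Prime).ne_zero
    refine (pow_le_one_iff_of_nonneg (v.nonneg ζ) hd).mp ?_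
    rw [← map_pow, hζ.pow_eq_one, map_one]
  let M : Matrix (Fin (p ^ (2 * r))) (Fin (p ^ (2 * r))) (Polynomial ℤ) :=
    Matrix.of fun n k => B k n
  have hdiag (n : ℕ) : B n n = 1 := by
    refine mul_right_cancel₀ (qPoch_ne_zero n) ?_
    simpa [qPoch] using hB1 n n le_rfl
  have hdet : M.det = 1 := by
    have hM : M.IsUpperTriangular := fun i j hij => hB0 _ _ hij
    rw [Matrix.det_of_isUpperTriangular hM]
    exact Finset.prod_eq_one fun i _ => hdiag i
  let φ : Polynomial ℤ →+* K := (Polynomial.aeval ζ).toRingHom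
  have hUM : U = M.map φ := Matrix.ext hU
  have hinv : M.adjugate.map φ * U = 1 := by
    rw [hUM, ← Matrix.map_mul, Matrix.adjugate_mul, hdet, one_smul]
    exact Matrix.map_one φ (map_zero φ) (map_one φ)
  have hle (A : Matrix (Fin (p ^ (2 * r))) (Fin (p ^ (2 * r))) (Polynomial ℤ))
      (y : Fin (p ^ (2 * r)) → K) : ⨆ n, v ((A.map φ).mulVec y n) ≤ ⨆ n, v (y n) :=
    Matrix.iSup_mulVec_le hna (fun i j => AbsoluteValue.aeval_int_le_one hna hζ1 (A i j)) y
  refine le_antisymm (hUM ▸ hle M x) ?_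
  simpa [Matrix.mulVec_mulVec, hinv] using hle M.adjugate (U.mulVec x)
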